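/- There is no conical ruled translating soliton of the inverse mean curvature flow in 𝕃³: there do not exist a point p ∈ ℝ³, a vector V ∈ ℝ³, a smooth curve β : I → ℝ³ on a nonempty open interval I with β'(s) ≠ 0 for all s ∈ I, and a nonempty open interval J ⊆ ℝ, such that the conical ruled surface X(s,t) = p + t·β(s) (i.e. with constant directrix γ ≡ p) is nondegenerate (EG − F² ≠ 0) and satisfies the translating soliton equation (★) for every s ∈ I and t ∈ J. -/

import Mathlib

noncomputable section

open Real

/-- The Lorentzian inner product on `𝕃³ = ℝ³`: `⟨x,y⟩ = x₁y₁ + x₂y₂ − x₃y₃`. -/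
def Lprod (u v : Fin 3 → ℝ) : ℝ := u 0 * v 0 + u 1 * v 1 - u 2 * v 2

/-- The mixed product `(u,v,w) = det(u,v,w)`. -/
def mixed (u v w : Fin 3 → ℝ) : ℝ :=
  u 0 * (v 1 * w 2 - v 2 * w 1) - u 1 * (v 0 * w 2 - v 2 * w 0) +
    u 2 * (v 0 * w 1 - v 1 * w 0)

/-- `X_s = γ' + t β'` for the ruled surface `X(s,t) = γ(s) + t β(s)`. -/
def Xs (γ β : ℝ → Fin 3 → ℝ) (s t : ℝ) : Fin 3 → ℝ := deriv γ s + t • deriv β s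

/-- `X_ss = γ'' + t β''`. -/
def Xss (γ β : ℝ → Fin 3 → ℝ) (s t : ℝ) : Fin 3 → ℝ :=
  deriv (deriv γ) s + t • deriv (deriv β) s

/-- Nondegeneracy at `(s,t)`: `EG − F² ≠ 0`. -/
def Nondeg (γ β : ℝ → Fin 3 → ℝ) (s t : ℝ) : Prop :=
  Lprod (Xs γ β s t) (Xs γ β s t) * Lprod (β s) (β s) -
      (Lprod (Xs γ β s t) (β s)) ^ 2 ≠ 0

/-- The translating soliton equation (★) of the IMCF at `(s,t)`:
`(X_s,X_t,V)·[G·(X_s,X_t,X_ss) − 2F·(X_s,X_t,X_st)] = 2(EG − F²)²`,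
where `X_t = β` and `X_st = β'`. -/
def SolitonEq (γ β : ℝ → Fin 3 → ℝ) (V : Fin 3 → ℝ) (s t : ℝ) : Prop :=
  mixed (Xs γ β s t) (β s) V *
      (Lprod (β s) (β s) * mixed (Xs γ β s t) (β s) (Xss γ β s t) -
        2 * Lprod (Xs γ β s t) (β s) * mixed (Xs γ β s t) (β s) (deriv β s)) =
    2 * (Lprod (Xs γ β s t) (Xs γ β s t) * Lprod (β s) (β s) -
          (Lprod (Xs γ β s t) (β s)) ^ 2) ^ 2

/-- For a constant directrix, nondegeneracy at `(s,t)` forces `t ≠ 0` and the nondegeneracy of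
`β'(s), β(s)`. -/
theorem Nondeg.ne_zero_of_const {p : Fin 3 → ℝ} {β : ℝ → Fin 3 → ℝ} {s t : ℝ}
    (h : Nondeg (fun _ => p) β s t) :
    t ≠ 0 ∧ Lprod (deriv β s) (deriv β s) * Lprod (β s) (β s) -
      (Lprod (deriv β s) (β s)) ^ 2 ≠ 0 := by
  have key : t ^ 2 * (Lprod (deriv β s) (deriv β s) * Lprod (β s) (β s) -
      (Lprod (deriv β s) (β s)) ^ 2) ≠ 0 := by
    refine fun h0 => h (Eq.trans ?_ h0)
    simp [Xs, Lprod]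
    ring
  exact ⟨fun ht => key (by simp [ht]), right_ne_zero_of_mul key⟩

/-- For a constant directrix and `t ≠ 0`, the soliton equation is affine in `t`. -/
theorem SolitonEq.eq_mul_of_const {p V : Fin 3 → ℝ} {β : ℝ → Fin 3 → ℝ} {s t : ℝ}
    (h : SolitonEq (fun _ => p) β V s t) (ht : t ≠ 0) :
    mixed (deriv β s) (β s) V *
        (Lprod (β s) (β s) * mixed (deriv β s) (β s) (deriv (deriv β) s)) =
      t * (2 * (Lprod (deriv β s) (deriv β s) * Lprod (β s) (β s) -
        (Lprod (deriv β s) (β s)) ^ 2) ^ 2) := by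
  apply mul_left_cancel₀ (pow_ne_zero 3 ht)
  simp [SolitonEq, Xs, Xss, Lprod, mixed] at h
  simp only [Lprod, mixed]
  linear_combination h

/-- there is no conical ruled translating soliton of the IMCF in `𝕃³`. -/
theorem no_conical_translating_soliton :
    ¬ ∃ (p V : Fin 3 → ℝ) (β : ℝ → Fin 3 → ℝ) (I J : Set ℝ),
      IsOpen I ∧ I.Nonempty ∧ I.OrdConnected ∧
      IsOpen J ∧ J.Nonempty ∧ J.OrdConnected ∧
      ContDiffOn ℝ (⊤ : ℕ∞) β I ∧ (∀ s ∈ I, deriv β s ≠ 0) ∧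
      (∀ s ∈ I, ∀ t ∈ J, Nondeg (fun _ => p) β s t) ∧
      (∀ s ∈ I, ∀ t ∈ J, SolitonEq (fun _ => p) β V s t) := by
  rintro ⟨p, V, β, I, J, -, ⟨s, hs⟩, -, hJ, ⟨t, ht⟩, -, -, -, hN, hS⟩
  obtain ⟨u, hu, hut⟩ : ∃ u ∈ J, u ≠ t := by
    obtain ⟨ε, hε, hball⟩ := Metric.isOpen_iff.1 hJ t ht
    refine ⟨t + ε / 2, hball ?_, by simpa using hε.ne'⟩
    rw [Metric.mem_ball, Real.dist_eq, add_sub_cancel_left, abs_of_pos (by linarith)]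
    linarith
  obtain ⟨ht0, hD⟩ := (hN s hs t ht).ne_zero_of_const
  have hu0 := (hN s hs u hu).ne_zero_of_const.1
  exact hut (mul_right_cancel₀ (mul_ne_zero two_ne_zero (pow_ne_zero 2 hD))
    (((hS s hs u hu).eq_mul_of_const hu0).symm.trans ((hS s hs t ht).eq_mul_of_const ht0)))
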